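/- Let k ∈ C³(ℝ^d × ℝ^d; ℝ) be symmetric and s ∈ C²(ℝ^d; ℝ^d), and let k_π be the associated Stein kernel, with F(μ) = (1/2)∬ k_π(x,y) dμ(x)dμ(y). Assume there is a continuous convex function L : ℝ^d → [0,∞), integrable with respect to every probability measure with finite second moment, such that for every y ∈ ℝ^d the maps x ↦ ∇₁k_π(x,y) and x ↦ ∇₂k_π(x,y) are L(y)-Lipschitz. Let μ₀ be a compactly supported probability measure on ℝ^d, fix γ > 0, and define recursively v_{μ_n}(y) = ∫ ∇₂k_π(x,y) dμ_n(x) and μ_{n+1} = (id − γ v_{μ_n})_# μ_n. Suppose there is M > 0 with (∫ L(x)² dμ_n(x))^{1/2} ≤ M for every n ≥ 0, and γ ≤ 1/M. Then for every n ≥ 0, F(μ_{n+1}) − F(μ_n) ≤ −γ(1 − γM) ∫ ‖v_{μ_n}(x)‖² dμ_n(x) ≤ 0; in particular the sequence (F(μ_n))_{n≥0} is non-increasing. -/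

import Mathlib

open MeasureTheory Function Set
open scoped RealInnerProductSpace NNReal ENNReal

noncomputable section

/-- `ℝ^d` with the Euclidean structure. -/
abbrev Ed (d : ℕ) := EuclideanSpace ℝ (Fin d)

variable {d : ℕ}

/-- Gradient of a kernel in its first variable, `∇₁k(x,y)`. -/
def grad1 (k : Ed d → Ed d → ℝ) (x y : Ed d) : Ed d :=
  gradient (fun x' => k x' y) x

/-- Gradient of a kernel in its second variable, `∇₂k(x,y)`. -/
def grad2 (k : Ed d → Ed d → ℝ) (x y : Ed d) : Ed d :=
  gradient (fun y' => k x y') y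

/-- `div₁∇₂ k (x,y) = Σ_i ∂²k/∂x_i∂y_i (x,y)`. -/
def div1grad2 (k : Ed d → Ed d → ℝ) (x y : Ed d) : ℝ :=
  ∑ i : Fin d,
    fderiv ℝ (fun x' => fderiv ℝ (fun y' => k x' y') y (EuclideanSpace.single i 1)) x
      (EuclideanSpace.single i 1)

/-- The Stein kernel `k_π` built from the base kernel `k` and the score `s = ∇ log π`. -/
def steinKernel (k : Ed d → Ed d → ℝ) (s : Ed d → Ed d) (x y : Ed d) : ℝ :=
  ⟪s x, s y⟫ * k x y + ⟪s x, grad2 k x y⟫ + ⟪grad1 k x y, s y⟫ + div1grad2 k x y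

/-- Hessian of `x ↦ k(x,y)`, as a continuous linear map (`H₁k(x,y)`). -/
def hess1 (k : Ed d → Ed d → ℝ) (x y : Ed d) : Ed d →L[ℝ] Ed d :=
  fderiv ℝ (fun x' => grad1 k x' y) x

/-- Laplacian as the sum of second directional derivatives along the standard basis. -/
def lap (f : Ed d → ℝ) (x : Ed d) : ℝ :=
  ∑ i : Fin d,
    fderiv ℝ (fun x' => fderiv ℝ f x' (EuclideanSpace.single i 1)) x (EuclideanSpace.single i 1)

lemma aux_hasFD {U : Ed d → Ed d → ℝ} (hU : Differentiable ℝ (uncurry U)) (x y : Ed d) :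
    HasFDerivAt (fun x' => U x' y)
      ((fderiv ℝ (uncurry U) (x, y)).comp (ContinuousLinearMap.inl ℝ (Ed d) (Ed d))) x := by
  have h1 := (hU (x, y)).hasFDerivAt
  have h2 : HasFDerivAt (fun x' : Ed d => (x', y)) (ContinuousLinearMap.inl ℝ (Ed d) (Ed d)) x :=
    hasFDerivAt_prodMk_left x y
  exact HasFDerivAt.comp (f := fun x' : Ed d => (x', y)) x h1 h2

lemma aux_hasFD2 {U : Ed d → Ed d → ℝ} (hU : Differentiable ℝ (uncurry U)) (x y : Ed d) :
    HasFDerivAt (fun y' => U x y')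
      ((fderiv ℝ (uncurry U) (x, y)).comp (ContinuousLinearMap.inr ℝ (Ed d) (Ed d))) y := by
  have h1 := (hU (x, y)).hasFDerivAt
  have h2 : HasFDerivAt (fun y' : Ed d => (x, y')) (ContinuousLinearMap.inr ℝ (Ed d) (Ed d)) y :=
    hasFDerivAt_prodMk_right x y
  exact HasFDerivAt.comp (f := fun y' : Ed d => (x, y')) y h1 h2

lemma aux_grad1 {U : Ed d → Ed d → ℝ} (hU : Differentiable ℝ (uncurry U)) (x y : Ed d) :
    grad1 U x y = (InnerProductSpace.toDual ℝ (Ed d)).symm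
      ((fderiv ℝ (uncurry U) (x, y)).comp (ContinuousLinearMap.inl ℝ (Ed d) (Ed d))) := by
  unfold grad1 gradient
  rw [(aux_hasFD hU x y).fderiv]

lemma aux_grad2 {U : Ed d → Ed d → ℝ} (hU : Differentiable ℝ (uncurry U)) (x y : Ed d) :
    grad2 U x y = (InnerProductSpace.toDual ℝ (Ed d)).symm
      ((fderiv ℝ (uncurry U) (x, y)).comp (ContinuousLinearMap.inr ℝ (Ed d) (Ed d))) := by
  unfold grad2 gradient
  rw [(aux_hasFD2 hU x y).fderiv]

lemma aux_inner1 {U : Ed d → Ed d → ℝ} (hU : Differentiable ℝ (uncurry U)) (x y a : Ed d) :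
    ⟪grad1 U x y, a⟫ = fderiv ℝ (uncurry U) (x, y) (a, 0) := by
  rw [aux_grad1 hU, InnerProductSpace.toDual_symm_apply]; rfl

lemma aux_inner2 {U : Ed d → Ed d → ℝ} (hU : Differentiable ℝ (uncurry U)) (x y a : Ed d) :
    ⟪grad2 U x y, a⟫ = fderiv ℝ (uncurry U) (x, y) (0, a) := by
  rw [aux_grad2 hU, InnerProductSpace.toDual_symm_apply]; rfl

lemma aux_cd1 {U : Ed d → Ed d → ℝ} {m n : WithTop ℕ∞} (hU : ContDiff ℝ n (uncurry U))
    (hmn : m + 1 ≤ n) : ContDiff ℝ m (fun p : Ed d × Ed d => grad1 U p.1 p.2) := by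
  have hd : Differentiable ℝ (uncurry U) := hU.differentiable (by
    rintro rfl; simp at hmn)
  have : (fun p : Ed d × Ed d => grad1 U p.1 p.2) = fun p =>
      (InnerProductSpace.toDual ℝ (Ed d)).symm
      ((fderiv ℝ (uncurry U) p).comp (ContinuousLinearMap.inl ℝ (Ed d) (Ed d))) := by
    funext p; rw [aux_grad1 hd]
  rw [this]
  exact (InnerProductSpace.toDual ℝ (Ed d)).symm.contDiff.comp
    ((hU.fderiv_right hmn).clm_comp contDiff_const)

lemma aux_cd2 {U : Ed d → Ed d → ℝ} {m n : WithTop ℕ∞} (hU : ContDiff ℝ n (uncurry U))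
    (hmn : m + 1 ≤ n) : ContDiff ℝ m (fun p : Ed d × Ed d => grad2 U p.1 p.2) := by
  have hd : Differentiable ℝ (uncurry U) := hU.differentiable (by
    rintro rfl; simp at hmn)
  have : (fun p : Ed d × Ed d => grad2 U p.1 p.2) = fun p =>
      (InnerProductSpace.toDual ℝ (Ed d)).symm
      ((fderiv ℝ (uncurry U) p).comp (ContinuousLinearMap.inr ℝ (Ed d) (Ed d))) := by
    funext p; rw [aux_grad2 hd]
  rw [this]
  exact (InnerProductSpace.toDual ℝ (Ed d)).symm.contDiff.comp
    ((hU.fderiv_right hmn).clm_comp contDiff_const)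

lemma aux_div {k : Ed d → Ed d → ℝ} (hk : ContDiff ℝ 3 (uncurry k)) (x y : Ed d) :
    div1grad2 k x y = ∑ i : Fin d,
      fderiv ℝ (fun p : Ed d × Ed d => fderiv ℝ (uncurry k) p (0, EuclideanSpace.single i 1)) (x, y)
        (EuclideanSpace.single i 1, 0) := by
  have hd : Differentiable ℝ (uncurry k) := hk.differentiable (by norm_num)
  unfold div1grad2
  refine Finset.sum_congr rfl fun i _ => ?_
  have h0 : (fun x' => fderiv ℝ (fun y' => k x' y') y (EuclideanSpace.single i (1:ℝ))) =
      fun x' => fderiv ℝ (uncurry k) (x', y) (0, EuclideanSpace.single i 1) := by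
    funext x'
    rw [(aux_hasFD2 hd x' y).fderiv]; rfl
  rw [h0]
  have hc : ContDiff ℝ 2 (fun p : Ed d × Ed d =>
      fderiv ℝ (uncurry k) p (0, EuclideanSpace.single i 1)) :=
    (hk.fderiv_right (m := 2) (by norm_num)).clm_apply contDiff_const
  have := aux_hasFD (U := fun a b => fderiv ℝ (uncurry k) (a, b) (0, EuclideanSpace.single i 1))
    (hc.differentiable (by norm_num)) x y
  rw [this.fderiv]; rfl

lemma aux_stein_cd {k : Ed d → Ed d → ℝ} {s : Ed d → Ed d} (hk : ContDiff ℝ 3 (uncurry k))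
    (hs : ContDiff ℝ 2 s) : ContDiff ℝ 1 (uncurry (steinKernel k s)) := by
  have h1 : ContDiff ℝ 1 (fun p : Ed d × Ed d => s p.1) := (hs.of_le (by norm_num)).comp contDiff_fst
  have h2 : ContDiff ℝ 1 (fun p : Ed d × Ed d => s p.2) := (hs.of_le (by norm_num)).comp contDiff_snd
  have hk1 : ContDiff ℝ 1 (fun p : Ed d × Ed d => k p.1 p.2) := hk.of_le (by norm_num)
  have g1 : ContDiff ℝ 1 (fun p : Ed d × Ed d => grad1 k p.1 p.2) := aux_cd1 hk (by norm_num)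
  have g2 : ContDiff ℝ 1 (fun p : Ed d × Ed d => grad2 k p.1 p.2) := aux_cd2 hk (by norm_num)
  have g3 : ContDiff ℝ 1 (fun p : Ed d × Ed d => div1grad2 k p.1 p.2) := by
    simp_rw [aux_div hk]
    refine ContDiff.sum fun i _ => ?_
    have hc : ContDiff ℝ 2 (fun p : Ed d × Ed d =>
      fderiv ℝ (uncurry k) p (0, EuclideanSpace.single i 1)) :=
      (hk.fderiv_right (m := 2) (by norm_num)).clm_apply contDiff_const
    exact (hc.fderiv_right (m := 1) (by norm_num)).clm_apply contDiff_const
  exact ((((h1.inner ℝ h2).mul hk1).add (h1.inner ℝ g2)).add (g1.inner ℝ h2)).add g3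

lemma aux_fd_swap {k : Ed d → Ed d → ℝ} (hd : Differentiable ℝ (uncurry k))
    (hksymm : ∀ x y, k x y = k y x) (p : Ed d × Ed d) (a b : Ed d) :
    fderiv ℝ (uncurry k) p.swap (b, a) = fderiv ℝ (uncurry k) p (a, b) := by
  have h0 : uncurry k = uncurry k ∘ (ContinuousLinearEquiv.prodComm ℝ (Ed d) (Ed d)) := by
    funext q; exact hksymm _ _
  have h1 : HasFDerivAt (uncurry k ∘ (ContinuousLinearEquiv.prodComm ℝ (Ed d) (Ed d))) _ p :=
    HasFDerivAt.comp p (hd p.swap).hasFDerivAt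
      (ContinuousLinearEquiv.prodComm ℝ (Ed d) (Ed d)).hasFDerivAt
  rw [← h0] at h1
  rw [h1.fderiv]; rfl

lemma aux_stein_symm {k : Ed d → Ed d → ℝ} {s : Ed d → Ed d} (hk : ContDiff ℝ 3 (uncurry k))
    (hksymm : ∀ x y, k x y = k y x) (x y : Ed d) : steinKernel k s x y = steinKernel k s y x := by
  have hd : Differentiable ℝ (uncurry k) := hk.differentiable (by norm_num)
  have e1 : ∀ x y, grad1 k x y = grad2 k y x := by
    intro x y; unfold grad1 grad2; simp_rw [hksymm _ y]
  have e2 : div1grad2 k x y = div1grad2 k y x := by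
    rw [aux_div hk, aux_div hk]
    refine Finset.sum_congr rfl fun i _ => ?_
    set e : Ed d := EuclideanSpace.single i 1
    have hQ : Differentiable ℝ (fderiv ℝ (uncurry k)) :=
      (hk.fderiv_right (m := 2) (by norm_num)).differentiable (by norm_num)
    have hq : ∀ (p u w : Ed d × Ed d), fderiv ℝ (fun p => fderiv ℝ (uncurry k) p u) p w =
        fderiv ℝ (fderiv ℝ (uncurry k)) p w u := by
      intro p u w
      have : HasFDerivAt (fun p => fderiv ℝ (uncurry k) p u) _ p :=
        (hQ p).hasFDerivAt.clm_apply (hasFDerivAt_const u p)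
      rw [this.fderiv]; simp
    have hsym : fderiv ℝ (fderiv ℝ (uncurry k)) (x, y) (e, 0) (0, e) =
        fderiv ℝ (fderiv ℝ (uncurry k)) (x, y) (0, e) (e, 0) :=
      (hk.contDiffAt.isSymmSndFDerivAt (by simp only [minSmoothness_of_isRCLikeNormedField]; norm_num)) _ _
    have hsw : (fun p => fderiv ℝ (uncurry k) p (e, 0)) =
        (fun p => fderiv ℝ (uncurry k) p (0, e)) ∘
          (ContinuousLinearEquiv.prodComm ℝ (Ed d) (Ed d)) := by
      funext p
      exact (aux_fd_swap hd hksymm p e 0).symm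
    have hdq : Differentiable ℝ (fun p => fderiv ℝ (uncurry k) p (0, e)) := fun p =>
      (hQ p).clm_apply (differentiableAt_const _)
    have h1 : HasFDerivAt ((fun p => fderiv ℝ (uncurry k) p (0, e)) ∘
          (ContinuousLinearEquiv.prodComm ℝ (Ed d) (Ed d))) _ (x, y) :=
      HasFDerivAt.comp (x, y) (hdq (y, x)).hasFDerivAt
        (ContinuousLinearEquiv.prodComm ℝ (Ed d) (Ed d)).hasFDerivAt
    rw [hq, hsym, ← hq, hsw, h1.fderiv]; rfl
  unfold steinKernel
  rw [e2, e1 x y, e1 y x, hksymm x y, real_inner_comm (s x) (s y),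
    real_inner_comm (s y) (grad2 k y x), real_inner_comm (s x) (grad2 k x y)]
  ring

/-- Pointwise second order bound along a segment. -/
lemma aux_pointwise {K : Ed d → Ed d → ℝ} (hK : ContDiff ℝ 1 (uncurry K))
    (hsymm : ∀ x y, K x y = K y x) {L : Ed d → ℝ} 
    (hLconvex : ConvexOn ℝ univ L)
    (hLip1 : ∀ y x x', ‖grad1 K x y - grad1 K x' y‖ ≤ L y * ‖x - x'‖)
    (hLip2 : ∀ y x x', ‖grad2 K x y - grad2 K x' y‖ ≤ L y * ‖x - x'‖)
    (x y a b : Ed d) :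
    K (x + a) (y + b) - K x y ≤ ⟪grad2 K y x, a⟫ + ⟪grad2 K x y, b⟫ +
      ((L x + L y) / 6 + (L (x + a) + L (y + b)) / 3) * (‖a‖ * ‖b‖) +
      (1/2) * (L x * ‖b‖ ^ 2 + L y * ‖a‖ ^ 2) := by
  have hd : Differentiable ℝ (uncurry K) := hK.differentiable (by norm_num)
  have e1 : ∀ x y, grad1 K x y = grad2 K y x := by
    intro x y; unfold grad1 grad2; simp_rw [hsymm _ y]
  have hder : ∀ t : ℝ, HasDerivAt (fun t : ℝ => K (x + t • a) (y + t • b))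
      (⟪grad2 K (y + t • b) (x + t • a), a⟫ + ⟪grad2 K (x + t • a) (y + t • b), b⟫) t := by
    intro t
    have h1 : HasDerivAt (fun t : ℝ => ((x + t • a, y + t • b) : Ed d × Ed d)) (a, b) t := by
      have ha : HasDerivAt (fun t : ℝ => x + t • a) a t := by
        simpa using ((hasDerivAt_id t).smul_const a).const_add x
      have hb : HasDerivAt (fun t : ℝ => y + t • b) b t := by
        simpa using ((hasDerivAt_id t).smul_const b).const_add y
      exact ha.prodMk hb
    have h2 := (hd (x + t • a, y + t • b)).hasFDerivAt.comp_hasDerivAt t h1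
    rw [← e1, aux_inner1 hd, aux_inner2 hd, ← map_add]
    have e : ((a, 0) : Ed d × Ed d) + (0, b) = (a, b) := by simp
    rw [e]
    exact h2
  -- one-sided increment bound
  have hinc : ∀ (x y a b : Ed d) (t : ℝ), 0 ≤ t → t ≤ 1 →
      ⟪grad2 K (x + t • a) (y + t • b), b⟫ - ⟪grad2 K x y, b⟫ ≤
        t * ((1 - t) * L y + t * L (y + b)) * (‖a‖ * ‖b‖) + t * (L x * ‖b‖ ^ 2) := by
    intro x y a b t ht0 ht1
    have hL : L (y + t • b) ≤ (1 - t) * L y + t * L (y + b) := by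
      have := hLconvex.2 (mem_univ y) (mem_univ (y + b)) (sub_nonneg.2 ht1) ht0 (by ring)
      have e : (1 - t) • y + t • (y + b) = y + t • b := by
        rw [smul_add, sub_smul, one_smul]; abel
      rw [e] at this
      simpa using this
    have hA := hLip2 (y + t • b) (x + t • a) x
    have hB := hLip1 x (y + t • b) y
    rw [e1, e1] at hB
    rw [add_sub_cancel_left, norm_smul, Real.norm_of_nonneg ht0] at hA hB
    have hs : ⟪grad2 K (x + t • a) (y + t • b), b⟫ - ⟪grad2 K x y, b⟫ =
        ⟪grad2 K (x + t • a) (y + t • b) - grad2 K x (y + t • b), b⟫ +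
        ⟪grad2 K x (y + t • b) - grad2 K x y, b⟫ := by
      simp only [inner_sub_left]; ring
    rw [hs]
    have i1 := real_inner_le_norm (grad2 K (x + t • a) (y + t • b) - grad2 K x (y + t • b)) b
    have i2 := real_inner_le_norm (grad2 K x (y + t • b) - grad2 K x y) b
    have hb := norm_nonneg b
    have j1 := mul_le_mul_of_nonneg_right hA hb
    have j2 := mul_le_mul_of_nonneg_right hB hb
    have j3 := mul_le_mul_of_nonneg_right hL
      (mul_nonneg (mul_nonneg ht0 (norm_nonneg a)) hb)
    nlinarith
  set P := (‖a‖ * ‖b‖) with hP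
  set c := ⟪grad2 K y x, a⟫ + ⟪grad2 K x y, b⟫ with hc
  set D := L x * ‖b‖ ^ 2 + L y * ‖a‖ ^ 2 with hD
  set A := L x + L y with hA
  set C := L (x + a) + L (y + b) with hC
  let ψ : ℝ → ℝ := fun t => K (x + t • a) (y + t • b) -
    (t * c + (t ^ 2 / 2 - t ^ 3 / 3) * (A * P) + t ^ 3 / 3 * (C * P) + t ^ 2 / 2 * D)
  have hψ : ∀ t, HasDerivAt ψ
      ((⟪grad2 K (y + t • b) (x + t • a), a⟫ + ⟪grad2 K (x + t • a) (y + t • b), b⟫) -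
        (c + (t - t ^ 2) * (A * P) + t ^ 2 * (C * P) + t * D)) t := by
    intro t
    refine (hder t).sub ?_
    have p1 := (hasDerivAt_id t).mul_const c
    have q2 : HasDerivAt (fun t : ℝ => t ^ 2 / 2) t t := by
      exact ((hasDerivAt_pow 2 t).div_const 2).congr_deriv (by norm_num)
    have q3 : HasDerivAt (fun t : ℝ => t ^ 3 / 3) (t ^ 2) t := by
      exact ((hasDerivAt_pow 3 t).div_const 3).congr_deriv (by norm_num)
    have := ((p1.add ((q2.sub q3).mul_const (A * P))).add (q3.mul_const (C * P))).add
      (q2.mul_const D)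
    rw [one_mul] at this
    exact this
  have hanti : AntitoneOn ψ (Icc 0 1) := by
    refine antitoneOn_of_deriv_nonpos (convex_Icc 0 1)
      (fun t _ => (hψ t).continuousAt.continuousWithinAt)
      (fun t _ => (hψ t).differentiableAt.differentiableWithinAt) ?_
    intro t ht
    rw [interior_Icc] at ht
    rw [(hψ t).deriv]
    have h1 := hinc x y a b t ht.1.le ht.2.le
    have h2 := hinc y x b a t ht.1.le ht.2.le
    rw [mul_comm ‖b‖ ‖a‖] at h2
    rw [← hP] at h1 h2
    rw [hc, hA, hC, hD]
    nlinarith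
  have := hanti (left_mem_Icc.2 zero_le_one) (right_mem_Icc.2 zero_le_one) zero_le_one
  simp only [ψ, one_smul, zero_smul, add_zero] at this
  nlinarith

lemma aux_int {X E : Type*} [TopologicalSpace X] [T2Space X] [MeasurableSpace X] [BorelSpace X]
    [SecondCountableTopology X]
    [NormedAddCommGroup E] {μ : Measure X}
    [IsFiniteMeasure μ] {S : Set X} (hS : IsCompact S) (h0 : μ Sᶜ = 0) {f : X → E}
    (hf : Continuous f) : Integrable f μ := by
  have hr : μ.restrict S = μ := Measure.restrict_eq_self_of_ae_mem (mem_ae_iff.2 h0)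
  rw [← hr]
  exact hf.continuousOn.integrableOn_compact hS

lemma aux_CS {X : Type*} [MeasurableSpace X] {μ : Measure X} {f g : X → ℝ}
    (hf : Integrable (fun x => f x ^ 2) μ) (hg : Integrable (fun x => g x ^ 2) μ)
    (hfm : AEStronglyMeasurable f μ) (hgm : AEStronglyMeasurable g μ)
    (hf0 : ∀ x, 0 ≤ f x) (hg0 : ∀ x, 0 ≤ g x) :
    ∫ x, f x * g x ∂μ ≤ √(∫ x, f x ^ 2 ∂μ) * √(∫ x, g x ^ 2 ∂μ) := by
  have := integral_mul_le_Lp_mul_Lq_of_nonneg (μ := μ) (p := 2) (q := 2) (f := f) (g := g)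
    Real.HolderConjugate.two_two (Filter.Eventually.of_forall hf0)
    (Filter.Eventually.of_forall hg0)
    (by simpa using (memLp_two_iff_integrable_sq hfm).2 hf)
    (by simpa using (memLp_two_iff_integrable_sq hgm).2 hg)
  simpa [Real.sqrt_eq_rpow] using this

/-- One descent step. -/
lemma aux_step {K : Ed d → Ed d → ℝ} (hK : ContDiff ℝ 1 (uncurry K))
    (hsymm : ∀ x y, K x y = K y x) {L : Ed d → ℝ} (hLpos : ∀ y, 0 ≤ L y) (hLcont : Continuous L)
    (hLconvex : ConvexOn ℝ univ L)
    (hLip1 : ∀ y x x', ‖grad1 K x y - grad1 K x' y‖ ≤ L y * ‖x - x'‖)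
    (hLip2 : ∀ y x x', ‖grad2 K x y - grad2 K x' y‖ ≤ L y * ‖x - x'‖)
    {μ : Measure (Ed d)} [IsProbabilityMeasure μ] {S : Set (Ed d)} (hS : IsCompact S)
    (h0 : μ Sᶜ = 0) {v : Ed d → Ed d} (hvc : Continuous v)
    (hv : ∀ y, v y = ∫ x, grad2 K x y ∂μ) {γ M : ℝ} (hγ : 0 < γ) 
    (hM1 : √(∫ x, L x ^ 2 ∂μ) ≤ M) (hM2 : √(∫ x, L (x - γ • v x) ^ 2 ∂μ) ≤ M) :
    (1/2) * (∫ x, ∫ y, K (x - γ • v x) (y - γ • v y) ∂μ ∂μ) - (1/2) * (∫ x, ∫ y, K x y ∂μ ∂μ) ≤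
      -(γ * (1 - γ * M)) * ∫ x, ‖v x‖ ^ 2 ∂μ := by
  have hKc : Continuous (fun p : Ed d × Ed d => K p.1 p.2) := hK.continuous
  have hg2 : Continuous (fun p : Ed d × Ed d => grad2 K p.1 p.2) :=
    (aux_cd2 (m := 0) hK (by norm_num)).continuous
  have hg2s : Continuous (fun p : Ed d × Ed d => grad2 K p.2 p.1) := hg2.comp continuous_swap
  have hSS : IsCompact (S ×ˢ S) := hS.prod hS
  have h00 : (μ.prod μ) (S ×ˢ S)ᶜ = 0 := by
    have hae : ∀ᵐ x ∂μ, x ∈ S := mem_ae_iff.2 h0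
    have := Measure.ae_prod_mem_iff_ae_ae_mem (μ := μ) (ν := μ)
      (hS.measurableSet.prod hS.measurableSet)
    have h2 : ∀ᵐ z ∂(μ.prod μ), z ∈ S ×ˢ S := this.2 (by
      filter_upwards [hae] with x hx
      filter_upwards [hae] with y hy
      exact ⟨hx, hy⟩)
    exact mem_ae_iff.1 h2
  have I2 : ∀ {f : Ed d × Ed d → ℝ}, Continuous f → Integrable f (μ.prod μ) :=
    fun hf => aux_int hSS h00 hf
  have I1 : ∀ {f : Ed d → ℝ}, Continuous f → Integrable f μ := fun hf => aux_int hS h0 hf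
  set h : Ed d → Ed d := fun x => -(γ • v x) with hh
  have hhc : Continuous h := (hvc.const_smul γ).neg
  have eh : ∀ x, x - γ • v x = x + h x := fun x => sub_eq_add_neg _ _
  simp_rw [eh] at hM2 ⊢
  set V := ∫ x, ‖v x‖ ^ 2 ∂μ with hV
  have hV0 : 0 ≤ V := integral_nonneg fun x => sq_nonneg _
  have hH : ∫ x, ‖h x‖ ^ 2 ∂μ = γ ^ 2 * V := by
    rw [hV, ← integral_const_mul]
    refine integral_congr_ae (Filter.Eventually.of_forall fun x => ?_)
    simp only [hh, norm_neg, norm_smul, mul_pow, Real.norm_eq_abs, sq_abs]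
  set H := √(∫ x, ‖h x‖ ^ 2 ∂μ) with hHdef
  have hH0 : 0 ≤ H := Real.sqrt_nonneg _
  have hHsq : H * H = γ ^ 2 * V := by
    rw [← hH]; exact Real.mul_self_sqrt (integral_nonneg fun x => sq_nonneg _)
  -- one-dimensional bounds
  have b1 : ∫ x, ‖h x‖ ∂μ ≤ H := by
    have := aux_CS (μ := μ) (f := fun x => ‖h x‖) (g := fun _ => 1) (I1 (by fun_prop))
      (I1 (by fun_prop)) (I1 (by fun_prop)).1 (I1 (by fun_prop)).1 (fun x => norm_nonneg _)
      (fun _ => zero_le_one)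
    simpa using this
  have b2 : ∫ x, L x ∂μ ≤ M := by
    have := aux_CS (μ := μ) (f := L) (g := fun _ => 1) (I1 (by fun_prop))
      (I1 (by fun_prop)) (I1 (by fun_prop)).1 (I1 (by fun_prop)).1 hLpos
      (fun _ => zero_le_one)
    refine le_trans ?_ hM1
    simpa using this
  have b3 : ∫ x, L x * ‖h x‖ ∂μ ≤ M * H := by
    have := aux_CS (μ := μ) (f := L) (g := fun x => ‖h x‖) (I1 (by fun_prop))
      (I1 (by fun_prop)) (I1 (by fun_prop)).1 (I1 (by fun_prop)).1 hLpos
      (fun _ => norm_nonneg _)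
    exact this.trans (mul_le_mul_of_nonneg_right hM1 hH0)
  have b4 : ∫ x, L (x + h x) * ‖h x‖ ∂μ ≤ M * H := by
    have := aux_CS (μ := μ) (f := fun x => L (x + h x)) (g := fun x => ‖h x‖) (I1 (by fun_prop))
      (I1 (by fun_prop)) (I1 (by fun_prop)).1 (I1 (by fun_prop)).1 (fun x => hLpos _)
      (fun _ => norm_nonneg _)
    exact this.trans (mul_le_mul_of_nonneg_right hM2 hH0)
  have n1 : 0 ≤ ∫ x, ‖h x‖ ∂μ := integral_nonneg fun x => norm_nonneg _
  have hM0 : 0 ≤ M := (Real.sqrt_nonneg _).trans hM1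
  have hLh0 : 0 ≤ ∫ x, L x * ‖h x‖ ∂μ :=
    integral_nonneg fun x => mul_nonneg (hLpos x) (norm_nonneg _)
  have b13 : (∫ x, L x * ‖h x‖ ∂μ) * (∫ x, ‖h x‖ ∂μ) ≤ M * (γ ^ 2 * V) := by
    rw [← hHsq, ← mul_assoc]
    exact mul_le_mul b3 b1 n1 (by positivity)
  have b14 : (∫ x, L (x + h x) * ‖h x‖ ∂μ) * (∫ x, ‖h x‖ ∂μ) ≤ M * (γ ^ 2 * V) := by
    rw [← hHsq, ← mul_assoc]
    exact mul_le_mul b4 b1 n1 (by positivity)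
  have b2' : (∫ x, L x ∂μ) * (γ ^ 2 * V) ≤ M * (γ ^ 2 * V) :=
    mul_le_mul_of_nonneg_right b2 (by positivity)
  -- the product bound
  have J1 : Continuous fun p : Ed d × Ed d => ⟪grad2 K p.2 p.1, h p.1⟫ := by fun_prop
  have J2 : Continuous fun p : Ed d × Ed d => ⟪grad2 K p.1 p.2, h p.2⟫ := by fun_prop
  have key : ∀ p : Ed d × Ed d, K (p.1 + h p.1) (p.2 + h p.2) - K p.1 p.2 ≤
      ⟪grad2 K p.2 p.1, h p.1⟫ + ⟪grad2 K p.1 p.2, h p.2⟫ +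
      ((1/6) * ((L p.1 * ‖h p.1‖) * ‖h p.2‖) + (1/6) * (‖h p.1‖ * (L p.2 * ‖h p.2‖)) +
      (1/3) * ((L (p.1 + h p.1) * ‖h p.1‖) * ‖h p.2‖) +
      (1/3) * (‖h p.1‖ * (L (p.2 + h p.2) * ‖h p.2‖))) +
      ((1/2) * (L p.1 * ‖h p.2‖ ^ 2) + (1/2) * (‖h p.1‖ ^ 2 * L p.2)) := by
    intro p
    have := aux_pointwise hK hsymm hLconvex hLip1 hLip2 p.1 p.2 (h p.1) (h p.2)
    linarith
  have hKh : Continuous fun p : Ed d × Ed d => K (p.1 + h p.1) (p.2 + h p.2) :=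
    hKc.comp (f := fun p : Ed d × Ed d => (p.1 + h p.1, p.2 + h p.2)) (by fun_prop)
  have mono := integral_mono (μ := μ.prod μ) ((I2 hKh).sub (I2 hKc)) (I2 (by fun_prop)) key
  have P1 : ∫ p, ⟪grad2 K p.2 p.1, h p.1⟫ ∂(μ.prod μ) = -(γ * V) := by
    rw [integral_prod _ (I2 J1), hV, ← integral_const_mul, ← integral_neg]
    refine integral_congr_ae (Filter.Eventually.of_forall fun x => ?_)
    have hi : Integrable (fun y => grad2 K y x) μ :=
      aux_int hS h0 (hg2.comp (f := fun y => (y, x)) (by fun_prop))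
    have := integral_inner (𝕜 := ℝ) hi (h x)
    simp only
    rw [integral_congr_ae (g := fun y => ⟪h x, grad2 K y x⟫)
      (Filter.Eventually.of_forall fun y => real_inner_comm _ _), this, ← hv]
    simp only [hh, inner_neg_left, inner_smul_left, real_inner_self_eq_norm_sq]
    simp
  have P2 : ∫ p, ⟪grad2 K p.1 p.2, h p.2⟫ ∂(μ.prod μ) = -(γ * V) := by
    rw [← P1]
    exact (integral_prod_swap (μ := μ) (ν := μ) (fun p => ⟪grad2 K p.1 p.2, h p.2⟫)).symm
  simp only [Pi.sub_apply] at mono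
  rw [integral_sub (I2 hKh) (I2 hKc), integral_prod _ (I2 hKh), integral_prod _ (I2 hKc),
    integral_add (I2 (by fun_prop)) (I2 (by fun_prop)),
    integral_add (I2 (by fun_prop)) (I2 (by fun_prop)),
    integral_add (I2 (by fun_prop)) (I2 (by fun_prop)),
    integral_add (I2 (by fun_prop)) (I2 (by fun_prop)),
    integral_add (I2 (by fun_prop)) (I2 (by fun_prop)),
    integral_add (I2 (by fun_prop)) (I2 (by fun_prop)),
    integral_add (I2 (by fun_prop)) (I2 (by fun_prop)), P1, P2] at mono
  simp only [integral_const_mul] at mono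
  have q1 := integral_prod_mul (μ := μ) (ν := μ) (fun x => L x * ‖h x‖) (fun y => ‖h y‖)
  have q2 := integral_prod_mul (μ := μ) (ν := μ) (fun x => ‖h x‖) (fun y => L y * ‖h y‖)
  have q3 := integral_prod_mul (μ := μ) (ν := μ) (fun x => L (x + h x) * ‖h x‖) (fun y => ‖h y‖)
  have q4 := integral_prod_mul (μ := μ) (ν := μ) (fun x => ‖h x‖) (fun y => L (y + h y) * ‖h y‖)
  have q5 := integral_prod_mul (μ := μ) (ν := μ) (fun x => L x) (fun y => ‖h y‖ ^ 2)
  have q6 := integral_prod_mul (μ := μ) (ν := μ) (fun x => ‖h x‖ ^ 2) (fun y => L y)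
  rw [q1, q2, q3, q4, q5, q6, hH] at mono
  nlinarith

/-- Descent lemma for KSD Descent: under the convex integrable Lipschitz
control `L` with `‖L‖_{L²(μ_n)} ≤ M` along the iterates and step size `γ ≤ 1/M`, each
iteration `μ_{n+1} = (id − γ v_{μ_n})_#μ_n` decreases `F(μ) = (1/2)∬k_π dμ⊗μ` by at least
`γ(1 − γM)∫‖v_{μ_n}‖²dμ_n`; in particular `n ↦ F(μ_n)` is non-increasing. -/
theorem statement10 {d : ℕ}
    (k : Ed d → Ed d → ℝ) (s : Ed d → Ed d)
    (hk : ContDiff ℝ 3 (uncurry k))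
    (hksymm : ∀ x y, k x y = k y x)
    (hs : ContDiff ℝ 2 s)
    (L : Ed d → ℝ) (hLpos : ∀ y, 0 ≤ L y) (hLcont : Continuous L)
    (hLconvex : ConvexOn ℝ univ L)
    (hLint : ∀ ρ : Measure (Ed d), IsProbabilityMeasure ρ →
      Integrable (fun x => ‖x‖ ^ 2) ρ → Integrable L ρ)
    (hLip1 : ∀ y x x', ‖grad1 (steinKernel k s) x y - grad1 (steinKernel k s) x' y‖ ≤
      L y * ‖x - x'‖)
    (hLip2 : ∀ y x x', ‖grad2 (steinKernel k s) x y - grad2 (steinKernel k s) x' y‖ ≤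
      L y * ‖x - x'‖)
    (F : Measure (Ed d) → ℝ)
    (hF : ∀ ρ : Measure (Ed d), F ρ = (1/2) * ∫ x, (∫ y, steinKernel k s x y ∂ρ) ∂ρ)
    (v : Measure (Ed d) → Ed d → Ed d)
    (hv : ∀ (ρ : Measure (Ed d)) (y), v ρ y = ∫ x, grad2 (steinKernel k s) x y ∂ρ)
    (μ₀ : Measure (Ed d)) [IsProbabilityMeasure μ₀]
    (hμ₀c : ∃ K : Set (Ed d), IsCompact K ∧ μ₀ Kᶜ = 0)
    (γ M : ℝ) (hγ : 0 < γ) (hM : 0 < M) (hγM : γ ≤ 1 / M)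
    (μseq : ℕ → Measure (Ed d))
    (hinit : μseq 0 = μ₀)
    (hrec : ∀ n, μseq (n + 1) = Measure.map (fun y => y - γ • v (μseq n) y) (μseq n))
    (hL2 : ∀ n, Real.sqrt (∫ x, L x ^ 2 ∂(μseq n)) ≤ M) :
    (∀ n : ℕ,
      F (μseq (n + 1)) - F (μseq n) ≤
        -(γ * (1 - γ * M)) * ∫ x, ‖v (μseq n) x‖ ^ 2 ∂(μseq n) ∧
      -(γ * (1 - γ * M)) * ∫ x, ‖v (μseq n) x‖ ^ 2 ∂(μseq n) ≤ 0) ∧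
    Antitone (fun n => F (μseq n)) := by
  have hK := aux_stein_cd hk hs
  have hKs := aux_stein_symm (s := s) hk hksymm
  generalize steinKernel k s = K at *
  have hg2 : Continuous (fun p : Ed d × Ed d => grad2 K p.1 p.2) :=
    (aux_cd2 (m := 0) hK (by norm_num)).continuous
  have hvc : ∀ (ρ : Measure (Ed d)) [IsProbabilityMeasure ρ] (S : Set (Ed d)), IsCompact S →
      ρ Sᶜ = 0 → Continuous (v ρ) := by
    intro ρ _ S hS h0
    have hr : ρ.restrict S = ρ := Measure.restrict_eq_self_of_ae_mem (mem_ae_iff.2 h0)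
    have h1 : Continuous (fun y => ∫ x in S, grad2 K x y ∂ρ) :=
      continuous_parametric_integral_of_continuous (f := fun y x => grad2 K x y)
        (hg2.comp continuous_swap) hS
    rw [hr] at h1
    have : v ρ = fun y => ∫ x, grad2 K x y ∂ρ := funext (hv ρ)
    rw [this]; exact h1
  have hinv : ∀ n, IsProbabilityMeasure (μseq n) ∧
      ∃ S : Set (Ed d), IsCompact S ∧ μseq n Sᶜ = 0 := by
    intro n
    induction n with
    | zero => rw [hinit]; exact ⟨inferInstance, hμ₀c⟩
    | succ n ih =>
      obtain ⟨hp, S, hS, h0⟩ := ih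
      have hc := hvc (μseq n) S hS h0
      have hT : Continuous (fun y => y - γ • v (μseq n) y) := by fun_prop
      rw [hrec n]
      refine ⟨Measure.isProbabilityMeasure_map hT.aemeasurable, _, hS.image hT, ?_⟩
      rw [Measure.map_apply hT.measurable (hS.image hT).measurableSet.compl]
      refine measure_mono_null ?_ h0
      intro x hx hxS
      exact hx ⟨x, hxS, rfl⟩
  have hstep : ∀ n : ℕ, F (μseq (n + 1)) - F (μseq n) ≤
      -(γ * (1 - γ * M)) * ∫ x, ‖v (μseq n) x‖ ^ 2 ∂(μseq n) := by
    intro n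
    obtain ⟨hp, S, hS, h0⟩ := hinv n
    have hc := hvc (μseq n) S hS h0
    have hT : Continuous (fun y => y - γ • v (μseq n) y) := by fun_prop
    have hM2 := hL2 (n + 1)
    obtain ⟨hp', S', hS', h0'⟩ := hinv (n + 1)
    rw [hF, hF]
    have hKc : Continuous (fun p : Ed d × Ed d => K p.1 p.2) := hK.continuous
    have e1 : ∀ x, ∫ y, K x y ∂(μseq (n+1)) =
        ∫ y, K x (y - γ • v (μseq n) y) ∂(μseq n) := by
      intro x
      rw [hrec n]
      exact integral_map hT.aemeasurable
        (hKc.comp (f := fun y => (x, y)) (by fun_prop)).aestronglyMeasurable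
    have hcont : Continuous fun x => ∫ y, K x y ∂(μseq (n+1)) := by
      have hr : (μseq (n+1)).restrict S' = μseq (n+1) :=
        Measure.restrict_eq_self_of_ae_mem (mem_ae_iff.2 h0')
      have h1 : Continuous (fun x => ∫ y in S', K x y ∂(μseq (n+1))) :=
        continuous_parametric_integral_of_continuous (f := fun x y => K x y) hKc hS'
      rwa [hr] at h1
    have e2 : ∫ x, (∫ y, K x y ∂(μseq (n+1))) ∂(μseq (n+1)) =
        ∫ x, (∫ y, K (x - γ • v (μseq n) x) (y - γ • v (μseq n) y) ∂(μseq n)) ∂(μseq n) := by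
      simp_rw [e1] at hcont ⊢
      rw [hrec n]
      exact integral_map hT.aemeasurable hcont.aestronglyMeasurable
    have e3 : ∫ x, L x ^ 2 ∂(μseq (n+1)) = ∫ x, L (x - γ • v (μseq n) x) ^ 2 ∂(μseq n) := by
      rw [hrec n]
      exact integral_map hT.aemeasurable (hLcont.pow 2).aestronglyMeasurable
    rw [e2]
    rw [e3] at hM2
    exact aux_step hK hKs hLpos hLcont hLconvex hLip1 hLip2 hS h0 hc (hv _) hγ (hL2 n) hM2
  have hneg : ∀ n : ℕ, -(γ * (1 - γ * M)) * ∫ x, ‖v (μseq n) x‖ ^ 2 ∂(μseq n) ≤ 0 := by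
    intro n
    have h1 : γ * M ≤ 1 := by rwa [le_div_iff₀ hM] at hγM
    have h2 : 0 ≤ ∫ x, ‖v (μseq n) x‖ ^ 2 ∂(μseq n) := integral_nonneg fun x => sq_nonneg _
    have h3 : 0 ≤ γ * (1 - γ * M) := mul_nonneg hγ.le (by linarith)
    have := mul_nonneg h3 h2
    linarith
  refine ⟨fun n => ⟨hstep n, hneg n⟩, antitone_nat_of_succ_le fun n => ?_⟩
  linarith [hstep n, hneg n]
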